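/- Fix n ≥ 2 and lengths l₁,…,l_{n−1} > 0, and consider the truck-with-trailers vector field h₁ on U = { y ∈ ℝⁿ : cos y_k ≠ 0 for k = 2,…,n }. Then for every i with 1 ≤ i ≤ n and every y ∈ U, the function S_i = L_{h₁}^{i−1} y₁ satisfies ∂S_i/∂y_i (y) = σ_i(y₂,…,y_i)² · ∏_{j=1}^{i−1} [ l_j⁻¹ σ_j(y₂,…,y_j) ]; in particular ∂S_i/∂y_i is strictly positive on each connected component of U where it does not change sign, and is everywhere nonzero on U. -/

import Mathlib

open Set

/-- The `k`-th coordinate (1-based, as in the paper) of `y ∈ ℝⁿ`. -/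
noncomputable def coord {n : ℕ} (y : EuclideanSpace ℝ (Fin n)) (k : ℕ) : ℝ :=
  if h : k - 1 < n then y ⟨k - 1, h⟩ else 0

/-- `σ_i(y₂, …, y_i) = ∏_{k=2}^i sec y_k` (so `σ₁ ≡ 1`). -/
noncomputable def sigmaFun {n : ℕ} (i : ℕ) (y : EuclideanSpace ℝ (Fin n)) : ℝ :=
  ∏ k ∈ Finset.Icc 2 i, (Real.cos (coord y k))⁻¹

/-- `η₁(y₂) = l₁⁻¹ tan y₂` and
`η_i(y₂, …, y_{i+1}) = (l_i⁻¹ tan y_{i+1} − l_{i-1}⁻¹ sin y_i)·σ_i` for `i ≥ 2`. -/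
noncomputable def etaFun {n : ℕ} (l : ℕ → ℝ) (i : ℕ)
    (y : EuclideanSpace ℝ (Fin n)) : ℝ :=
  if i = 1 then (l 1)⁻¹ * Real.tan (coord y 2)
  else ((l i)⁻¹ * Real.tan (coord y (i + 1)) - (l (i - 1))⁻¹ * Real.sin (coord y i)) *
    sigmaFun i y

/-- Lie derivative of a scalar function `φ` along a vector field `h` on `ℝⁿ`. -/
noncomputable def lieDeriv {n : ℕ} (h : EuclideanSpace ℝ (Fin n) → EuclideanSpace ℝ (Fin n))
    (φ : EuclideanSpace ℝ (Fin n) → ℝ) : EuclideanSpace ℝ (Fin n) → ℝ :=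
  fun y => fderiv ℝ φ y (h y)

/-- Repeated Lie derivatives. -/
noncomputable def lieIter {n : ℕ} (h : EuclideanSpace ℝ (Fin n) → EuclideanSpace ℝ (Fin n))
    (φ : EuclideanSpace ℝ (Fin n) → ℝ) : ℕ → EuclideanSpace ℝ (Fin n) → ℝ
  | 0 => φ
  | (i + 1) => lieDeriv h (lieIter h φ i)


open scoped ContDiff Topology

section Coordinates

variable {n : ℕ}

/-- The open set on which `cos y_k ≠ 0` for `2 ≤ k ≤ n`. -/
def cosDomain (n : ℕ) : Set (EuclideanSpace ℝ (Fin n)) :=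
  {y | ∀ k, 2 ≤ k → k ≤ n → Real.cos (coord y k) ≠ 0}

theorem contDiff_coord (k : ℕ) :
    ContDiff ℝ ∞ (fun y : EuclideanSpace ℝ (Fin n) => coord y k) := by
  unfold coord
  split_ifs with h
  · fun_prop
  · exact contDiff_const

theorem coord_add_smul_single (y : EuclideanSpace ℝ (Fin n)) (t : ℝ) (a : Fin n) (k : ℕ) :
    coord (y + t • EuclideanSpace.single a 1) k = coord y k + if k - 1 = a then t else 0 := by
  unfold coord
  by_cases h : k - 1 < n
  · simp [h, Fin.ext_iff]
  · have : k - 1 ≠ a := fun e => h (e ▸ a.isLt)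
    simp [h, this]

theorem isOpen_cosDomain : IsOpen (cosDomain n) := by
  have : cosDomain n = ⋂ k ∈ Finset.Icc 2 n,
      {y : EuclideanSpace ℝ (Fin n) | Real.cos (coord y k) ≠ 0} := by
    ext y
    simp [cosDomain]
  rw [this]
  exact isOpen_biInter_finset fun k _ =>
    isOpen_ne_fun (Real.continuous_cos.comp (contDiff_coord k).continuous) continuous_const

theorem contDiffAt_sigmaFun {i : ℕ} (hi : i ≤ n) {y : EuclideanSpace ℝ (Fin n)}
    (hy : y ∈ cosDomain n) : ContDiffAt ℝ ∞ (sigmaFun i) y := by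
  unfold sigmaFun
  refine contDiffAt_prod fun k hk => ?_
  obtain ⟨h2, hki⟩ := Finset.mem_Icc.1 hk
  exact (Real.contDiff_cos.comp (contDiff_coord k)).contDiffAt.inv (hy k h2 (hki.trans hi))

theorem contDiffAt_tan_coord {k : ℕ} (h2 : 2 ≤ k) (hk : k ≤ n) {y : EuclideanSpace ℝ (Fin n)}
    (hy : y ∈ cosDomain n) : ContDiffAt ℝ ∞ (fun z => Real.tan (coord z k)) y :=
  ContDiffAt.comp (g := Real.tan) y (Real.contDiffAt_tan.2 (hy k h2 hk))
    (contDiff_coord k).contDiffAt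

theorem contDiffAt_etaFun (l : ℕ → ℝ) {i : ℕ} (h1 : 1 ≤ i) (hi : i < n)
    {y : EuclideanSpace ℝ (Fin n)} (hy : y ∈ cosDomain n) : ContDiffAt ℝ ∞ (etaFun l i) y := by
  unfold etaFun
  split_ifs with h
  · exact contDiffAt_const.mul (contDiffAt_tan_coord le_rfl (by omega) hy)
  · exact ((contDiffAt_const.mul (contDiffAt_tan_coord (by omega) (by omega) hy)).sub
      (contDiffAt_const.mul (Real.contDiff_sin.comp (contDiff_coord i)).contDiffAt)).mul
      (contDiffAt_sigmaFun hi.le hy)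

theorem sigmaFun_add_smul_single {i : ℕ} {a : Fin n} (h : i ≤ a)
    (y : EuclideanSpace ℝ (Fin n)) (t : ℝ) :
    sigmaFun i (y + t • EuclideanSpace.single a 1) = sigmaFun i y := by
  unfold sigmaFun
  refine Finset.prod_congr rfl fun k hk => ?_
  have hk' := Finset.mem_Icc.1 hk
  rw [coord_add_smul_single, if_neg (by omega), add_zero]

theorem sigmaFun_one (y : EuclideanSpace ℝ (Fin n)) : sigmaFun 1 y = 1 := by
  simp [sigmaFun]

theorem sigmaFun_succ {i : ℕ} (h : 1 ≤ i) (y : EuclideanSpace ℝ (Fin n)) :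
    sigmaFun (i + 1) y = sigmaFun i y * (Real.cos (coord y (i + 1)))⁻¹ :=
  Finset.prod_Icc_succ_top (by omega) _

theorem sigmaFun_ne_zero {i : ℕ} (hi : i ≤ n) {y : EuclideanSpace ℝ (Fin n)}
    (hy : y ∈ cosDomain n) : sigmaFun i y ≠ 0 := by
  refine Finset.prod_ne_zero_iff.2 fun k hk => inv_ne_zero ?_
  obtain ⟨h2, hki⟩ := Finset.mem_Icc.1 hk
  exact hy k h2 (hki.trans hi)

/-- `η_i` does not depend on the coordinates beyond `y_{i+1}`. -/
theorem fderiv_etaFun_single_of_lt (l : ℕ → ℝ) {i : ℕ} (h1 : 1 ≤ i) {a : Fin n} (ha : i < a)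
    {y : EuclideanSpace ℝ (Fin n)} (hy : y ∈ cosDomain n) :
    fderiv ℝ (etaFun l i) y (EuclideanSpace.single a 1) = 0 := by
  have hd := (contDiffAt_etaFun l h1 (ha.trans a.isLt) hy).differentiableAt (by simp)
  rw [← hd.lineDeriv_eq_fderiv, lineDeriv]
  have : (fun t : ℝ => etaFun l i (y + t • EuclideanSpace.single a 1)) =
      fun _ => etaFun l i y := by
    funext t
    simp only [etaFun, sigmaFun_add_smul_single ha.le, coord_add_smul_single]
    rw [if_neg (by omega : ¬ 2 - 1 = (a : ℕ)), if_neg (by omega : ¬ i + 1 - 1 = (a : ℕ)),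
      if_neg (by omega : ¬ i - 1 = (a : ℕ))]
    simp only [add_zero]
  rw [this, deriv_const]

theorem fderiv_etaFun_single_self (l : ℕ → ℝ) {i : ℕ} (h1 : 1 ≤ i) {a : Fin n} (ha : i = a)
    {y : EuclideanSpace ℝ (Fin n)} (hy : y ∈ cosDomain n) :
    fderiv ℝ (etaFun l i) y (EuclideanSpace.single a 1) =
      (l i)⁻¹ * (Real.cos (coord y (i + 1)) ^ 2)⁻¹ * sigmaFun i y := by
  have hin : i < n := ha ▸ a.isLt
  have hd := (contDiffAt_etaFun l h1 hin hy).differentiableAt (by simp)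
  rw [← hd.lineDeriv_eq_fderiv, lineDeriv]
  have htan : HasDerivAt (fun t : ℝ => Real.tan (coord y (i + 1) + t))
      (Real.cos (coord y (i + 1)) ^ 2)⁻¹ 0 := by
    have h := Real.hasDerivAt_tan (x := coord y (i + 1) + 0)
      (by simpa using hy (i + 1) (by omega) hin)
    simpa using h.comp_const_add (coord y (i + 1)) 0
  obtain ⟨c, hc⟩ : ∃ c, (fun t : ℝ => etaFun l i (y + t • EuclideanSpace.single a 1)) =
      fun t => ((l i)⁻¹ * Real.tan (coord y (i + 1) + t) - c) * sigmaFun i y := by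
    by_cases hi : i = 1
    · refine ⟨0, ?_⟩
      funext t
      subst hi
      simp [etaFun, coord_add_smul_single, sigmaFun_one, ← ha]
    · refine ⟨(l (i - 1))⁻¹ * Real.sin (coord y i), ?_⟩
      funext t
      simp only [etaFun, if_neg hi, sigmaFun_add_smul_single ha.le, coord_add_smul_single]
      rw [if_pos (by omega : i + 1 - 1 = (a : ℕ)), if_neg (by omega : ¬ i - 1 = (a : ℕ)),
        add_zero]
  rw [hc]
  exact (((htan.const_mul _).sub_const c).mul_const _).deriv

theorem clm_apply_eq_sum_single (L : EuclideanSpace ℝ (Fin n) →L[ℝ] ℝ)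
    (v : EuclideanSpace ℝ (Fin n)) :
    L v = ∑ j, v j * L (EuclideanSpace.single j 1) := by
  conv_lhs => rw [← (EuclideanSpace.basisFun (Fin n) ℝ).sum_repr v]
  simp

end Coordinates

section LieDerivative

variable {n : ℕ} {h : EuclideanSpace ℝ (Fin n) → EuclideanSpace ℝ (Fin n)}
  {φ : EuclideanSpace ℝ (Fin n) → ℝ} {y : EuclideanSpace ℝ (Fin n)}

theorem ContDiffAt.lieDeriv (hφ : ContDiffAt ℝ ∞ φ y) (hh : ContDiffAt ℝ ∞ h y) :
    ContDiffAt ℝ ∞ (lieDeriv h φ) y :=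
  (hφ.fderiv_right (m := ∞) (by simp)).clm_apply hh

/-- If the directional derivative of `φ` along `v` vanishes near `y`, differentiating `L_h φ`
along `v` only differentiates the vector field. -/
theorem fderiv_lieDeriv_apply_of_eventually_eq_zero (hφ : ContDiffAt ℝ ∞ φ y)
    (hh : ContDiffAt ℝ ∞ h y) {v : EuclideanSpace ℝ (Fin n)}
    (hv : ∀ᶠ z in 𝓝 y, fderiv ℝ φ z v = 0) :
    fderiv ℝ (lieDeriv h φ) y v = fderiv ℝ φ y (fderiv ℝ h y v) := by
  have hd : DifferentiableAt ℝ (fderiv ℝ φ) y :=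
    (hφ.fderiv_right (m := ∞) (by simp)).differentiableAt (by simp)
  have hsymm : IsSymmSndFDerivAt ℝ φ y := hφ.isSymmSndFDerivAt
    (by simpa using WithTop.coe_le_coe.2 (le_top : (2 : ℕ∞) ≤ ⊤))
  have hzero : fderiv ℝ (fderiv ℝ φ) y (h y) v = 0 := by
    have h1 : fderiv ℝ (fun z => fderiv ℝ φ z v) y = 0 := by
      rw [Filter.EventuallyEq.fderiv_eq (f := fun _ => (0 : ℝ)) hv]
      simp
    rw [fderiv_clm_apply hd (differentiableAt_const v)] at h1
    simpa using congrArg (fun L => L (h y)) h1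
  unfold lieDeriv
  rw [fderiv_clm_apply hd (hh.differentiableAt (by simp))]
  simp [hsymm.eq v (h y), hzero]

end LieDerivative

section TruckField

variable {n : ℕ} {l : ℕ → ℝ} {h₁ : EuclideanSpace ℝ (Fin n) → EuclideanSpace ℝ (Fin n)}

theorem contDiffAt_truckField
    (hh₁ : ∀ y (j : Fin n), h₁ y j = if (j : ℕ) < n - 1 then etaFun l ((j : ℕ) + 1) y else 0)
    {y : EuclideanSpace ℝ (Fin n)} (hy : y ∈ cosDomain n) : ContDiffAt ℝ ∞ h₁ y := by
  refine contDiffAt_euclidean.2 fun j => ?_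
  simp only [hh₁]
  split_ifs with hj
  · exact contDiffAt_etaFun l (by omega) (by omega) hy
  · exact contDiffAt_const

theorem fderiv_truckField_apply
    (hh₁ : ∀ y (j : Fin n), h₁ y j = if (j : ℕ) < n - 1 then etaFun l ((j : ℕ) + 1) y else 0)
    {y : EuclideanSpace ℝ (Fin n)} (hy : y ∈ cosDomain n) (v : EuclideanSpace ℝ (Fin n))
    {j : Fin n} (hj : (j : ℕ) < n - 1) :
    fderiv ℝ h₁ y v j = fderiv ℝ (etaFun l ((j : ℕ) + 1)) y v := by
  have hd := (contDiffAt_truckField hh₁ hy).differentiableAt (by simp)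
  have h := ((EuclideanSpace.proj (𝕜 := ℝ) j).hasFDerivAt.comp y hd.hasFDerivAt).fderiv
  have he : EuclideanSpace.proj (𝕜 := ℝ) j ∘ h₁ = etaFun l ((j : ℕ) + 1) := by
    funext z
    simp [hh₁, hj]
  rw [← he, h]
  rfl

/-- One Lie derivative along the truck field: if `φ` depends only on the coordinates with index
at most `m`, then beyond `m` the derivative of `L_{h₁} φ` only sees the `m`-th component of the
field. -/
theorem fderiv_lieDeriv_truckField_single
    (hh₁ : ∀ y (j : Fin n), h₁ y j = if (j : ℕ) < n - 1 then etaFun l ((j : ℕ) + 1) y else 0)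
    {φ : EuclideanSpace ℝ (Fin n) → ℝ} {m : Fin n}
    (hφ : ∀ y ∈ cosDomain n, ContDiffAt ℝ ∞ φ y)
    (hdep : ∀ y ∈ cosDomain n, ∀ a : Fin n, m < a →
      fderiv ℝ φ y (EuclideanSpace.single a 1) = 0)
    {y : EuclideanSpace ℝ (Fin n)} (hy : y ∈ cosDomain n) {a : Fin n} (ha : m < a) :
    fderiv ℝ (lieDeriv h₁ φ) y (EuclideanSpace.single a 1) =
      fderiv ℝ (etaFun l ((m : ℕ) + 1)) y (EuclideanSpace.single a 1) *
        fderiv ℝ φ y (EuclideanSpace.single m 1) := by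
  have ha' : (m : ℕ) < a := ha
  rw [fderiv_lieDeriv_apply_of_eventually_eq_zero (hφ y hy) (contDiffAt_truckField hh₁ hy)
    (Filter.mem_of_superset (isOpen_cosDomain.mem_nhds hy) fun z hz => hdep z hz a ha),
    clm_apply_eq_sum_single, Finset.sum_eq_single m]
  · rw [fderiv_truckField_apply hh₁ hy _ (by omega)]
  · intro j _ hjm
    rcases lt_or_gt_of_ne hjm with hlt | hgt
    · have hlt' : (j : ℕ) < m := hlt
      rw [fderiv_truckField_apply hh₁ hy _ (by omega),
        fderiv_etaFun_single_of_lt l (by omega) (by omega) hy, zero_mul]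
    · rw [hdep y hy j hgt, mul_zero]
  · simp

theorem lieIter_truckField
    (hh₁ : ∀ y (j : Fin n), h₁ y j = if (j : ℕ) < n - 1 then etaFun l ((j : ℕ) + 1) y else 0)
    {y₁ : EuclideanSpace ℝ (Fin n) → ℝ} (hn : 0 < n) (hy₁ : ∀ y, y₁ y = y ⟨0, hn⟩)
    (m : ℕ) (hm : m < n) :
    (∀ y ∈ cosDomain n, ContDiffAt ℝ ∞ (lieIter h₁ y₁ m) y) ∧
    (∀ y ∈ cosDomain n, ∀ a : Fin n, m < a →
      fderiv ℝ (lieIter h₁ y₁ m) y (EuclideanSpace.single a 1) = 0) ∧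
    ∀ y ∈ cosDomain n, fderiv ℝ (lieIter h₁ y₁ m) y (EuclideanSpace.single ⟨m, hm⟩ 1) =
      (sigmaFun (m + 1) y) ^ 2 * ∏ j ∈ Finset.Icc 1 m, (l j)⁻¹ * sigmaFun j y := by
  induction m with
  | zero =>
    have he : lieIter h₁ y₁ 0 = EuclideanSpace.proj (𝕜 := ℝ) (⟨0, hn⟩ : Fin n) := funext hy₁
    rw [he]
    refine ⟨fun y _ => ContinuousLinearMap.contDiff _ |>.contDiffAt, fun y _ a ha => ?_,
      fun y _ => ?_⟩
    · rw [ContinuousLinearMap.fderiv]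
      simp [Fin.ext_iff, ha.ne]
    · rw [ContinuousLinearMap.fderiv]
      simp [sigmaFun_one]
  | succ m ih =>
    obtain ⟨hsmooth, hdep, hdiag⟩ := ih (by omega)
    have hstep {y : EuclideanSpace ℝ (Fin n)} (hy : y ∈ cosDomain n) {a : Fin n} (ha : m < a) :=
      fderiv_lieDeriv_truckField_single (m := ⟨m, by omega⟩) hh₁ hsmooth hdep hy (a := a) ha
    refine ⟨fun y hy => (hsmooth y hy).lieDeriv (contDiffAt_truckField hh₁ hy),
      fun y hy a ha => ?_, fun y hy => ?_⟩
    · rw [lieIter, hstep hy (by omega), fderiv_etaFun_single_of_lt l (by simp) ha hy, zero_mul]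
    · rw [lieIter, hstep hy (by simp), fderiv_etaFun_single_self l (i := m + 1) (by omega) rfl hy, hdiag y hy,
        sigmaFun_succ (i := m + 1) (by omega), Finset.prod_Icc_succ_top (by omega)]
      ring

end TruckField

/-- Diagonal partial derivative of the truck chained coordinates:
`∂S_i/∂y_i = σ_i² ∏_{j=1}^{i-1} l_j⁻¹ σ_j` on `U`; in particular it is everywhere
nonzero on `U`. -/
theorem stmt14 {n : ℕ} (hn : 2 ≤ n)
    (l : ℕ → ℝ) (hl : ∀ i, 1 ≤ i → i ≤ n - 1 → 0 < l i)
    (h₁ : EuclideanSpace ℝ (Fin n) → EuclideanSpace ℝ (Fin n))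
    (hh₁ : ∀ y (j : Fin n), h₁ y j = if (j : ℕ) < n - 1 then etaFun l ((j : ℕ) + 1) y else 0)
    (y₁ : EuclideanSpace ℝ (Fin n) → ℝ) (hy₁ : ∀ y, y₁ y = y ⟨0, by omega⟩) :
    ∀ i : ℕ, ∀ _hi : 1 ≤ i, ∀ _hin : i ≤ n,
      ∀ y : EuclideanSpace ℝ (Fin n),
        (∀ k, 2 ≤ k → k ≤ n → Real.cos (coord y k) ≠ 0) →
        fderiv ℝ (lieIter h₁ y₁ (i - 1)) y (EuclideanSpace.single ⟨i - 1, by omega⟩ 1) =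
          (sigmaFun i y) ^ 2 * ∏ j ∈ Finset.Icc 1 (i - 1), (l j)⁻¹ * sigmaFun j y ∧
        fderiv ℝ (lieIter h₁ y₁ (i - 1)) y (EuclideanSpace.single ⟨i - 1, by omega⟩ 1) ≠ 0 := by
  intro i hi hin y hy
  have hdiag := (lieIter_truckField hh₁ (by omega) hy₁ (i - 1) (by omega)).2.2 y hy
  rw [Nat.sub_add_cancel hi] at hdiag
  refine ⟨hdiag, hdiag ▸ mul_ne_zero (pow_ne_zero 2 (sigmaFun_ne_zero hin hy))
    (Finset.prod_ne_zero_iff.2 fun j hj => ?_)⟩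
  obtain ⟨h1, hji⟩ := Finset.mem_Icc.1 hj
  exact mul_ne_zero (inv_ne_zero (hl j h1 (by omega)).ne') (sigmaFun_ne_zero (by omega) hy)
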